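/- arXiv:1506.08547 — 2 statements merged into one kernel-verified Lean document; each statement's English description precedes it below -/
import Mathlib

section
/- Assume (ρ,∼) is weakly commutative. Fix f ∈ F ∪ {∅}; for a walk τ containing f, let W^f_τ denote the longest prefix of the flaw word of τ that ends with f (if f = ∅, every walk is said to contain f and W^∅_τ is the whole flaw word of τ). Let X^f be a valid set of walks each containing f. Then there exists a set of walks X^f_π and a bijection Φ^f : X^f → X^f_π with Φ^f(τ) ≡ τ for every τ ∈ X^f, such that: (a) for every τ ∈ X^f_π the word W = REV[W^f_τ] is π-stable and lies in Stab_π, and R_W = {f} whenever f ∈ F; and (b) for every word W, the set {τ ∈ X^f_π : REV[W^f_τ] = W} is valid. -/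
open scoped Classical

noncomputable section

namespace LLLFormal

/-- A walk: an initial state together with a list of (flaw, next-state) steps. -/
structure Walk (Ω F : Type*) where
  start : Ω
  steps : List (F × Ω)

variable {Ω F : Type*}

/-- Validity of a list of steps from a given state, w.r.t. a step relation. -/
def ValidFrom (step : F → Ω → Ω → Prop) : Ω → List (F × Ω) → Prop
  | _, [] => True
  | σ, (f, σ') :: rest => step f σ σ' ∧ ValidFrom step σ' rest

/-- The state reached after performing the steps `l` starting from `σ`. -/
def endOf (σ : Ω) (l : List (F × Ω)) : Ω := (l.map Prod.snd).getLastD σ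

/-- `τ` is a (valid) walk w.r.t. the step relation `step`. -/
def Walk.Valid (step : F → Ω → Ω → Prop) (τ : Walk Ω F) : Prop := ValidFrom step τ.start τ.steps

/-- The flaw word of a walk. -/
def Walk.word (τ : Walk Ω F) : List F := τ.steps.map Prod.fst

/-- The final state of a walk. -/
def Walk.final (τ : Walk Ω F) : Ω := endOf τ.start τ.steps

/-- The length of a walk. -/
def Walk.len (τ : Walk Ω F) : ℕ := τ.steps.length

/-- Product of the transition probabilities along a list of steps. -/
def prodRho (ρ : F → Ω → Ω → ℝ) : Ω → List (F × Ω) → ℝ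
  | _, [] => 1
  | σ, (f, σ') :: rest => ρ f σ σ' * prodRho ρ σ' rest

/-- The weight `p(τ)` of a walk. -/
def Walk.wt (ωinit : Ω → ℝ) (ρ : F → Ω → Ω → ℝ) (τ : Walk Ω F) : ℝ :=
  ωinit τ.start * prodRho ρ τ.start τ.steps

/-- `λ_W = ∏_i λ_{w_i}`. -/
def wordWt (lam : F → ℝ) (W : List F) : ℝ := (W.map lam).prod

/-- The data of the objects, flaws, actions and resampling oracles:
`mem f σ` means `σ ∈ f`; `Act f σ` is the action set `A(f,σ)`;
`ρ f σ σ'` is the probability `ρ(σ'|f,σ)`, whose support is exactly `A(f,σ)`. -/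
structure Setup (Ω F : Type*) [Fintype Ω] where
  mem : F → Ω → Prop
  flaw_nonempty : ∀ f, ∃ σ, mem f σ
  Act : F → Ω → Set Ω
  act_nonempty : ∀ f σ, mem f σ → (Act f σ).Nonempty
  ρ : F → Ω → Ω → ℝ
  ρ_nonneg : ∀ f σ σ', 0 ≤ ρ f σ σ'
  ρ_support : ∀ f σ, mem f σ → ∀ σ', (0 < ρ f σ σ' ↔ σ' ∈ Act f σ)
  ρ_total : ∀ f σ, mem f σ → ∑ σ' : Ω, ρ f σ σ' = 1

variable [Fintype Ω]

/-- A valid step `σ →^f σ'`. -/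
def Setup.step (S : Setup Ω F) (f : F) (σ σ' : Ω) : Prop := S.mem f σ ∧ σ' ∈ S.Act f σ

/-- A probability distribution on `Ω`. -/
def IsProb (ω : Ω → ℝ) : Prop := (∀ σ, 0 ≤ ω σ) ∧ ∑ σ : Ω, ω σ = 1

/-- A probability distribution on `Ω` with full support. -/
def IsPosProb (ω : Ω → ℝ) : Prop := (∀ σ, 0 < ω σ) ∧ ∑ σ : Ω, ω σ = 1

/-- `γ^init = max_{σ∈Ω} ωinit σ / ω σ`. -/
def gammaInit [Nonempty Ω] (ωinit ω : Ω → ℝ) : ℝ :=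
  Finset.univ.sup' Finset.univ_nonempty fun σ => ωinit σ / ω σ

/-- Condition (A): `λ_f ≥ ∑_{σ ∈ f : σ' ∈ A(f,σ)} ρ(σ'|f,σ) ω(σ)/ω(σ')`. -/
def CondA (S : Setup Ω F) (ω : Ω → ℝ) (lam : F → ℝ) : Prop :=
  ∀ (f : F) (σ' : Ω),
    lam f ≥ ∑ σ : Ω, if S.mem f σ ∧ σ' ∈ S.Act f σ then S.ρ f σ σ' * ω σ / ω σ' else 0

/-- `(F, ∼)` is a potential causality graph:
for every valid step `σ →^f σ'`, `F_{σ'} ⊆ (F_σ − {f}) ∪ Γ(f)`. -/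
def Causality (S : Setup Ω F) (sim : F → F → Prop) : Prop :=
  ∀ f σ σ', S.step f σ σ' → ∀ g, S.mem g σ' → (S.mem g σ ∧ g ≠ f) ∨ sim f g

/-- A finite set of flaws is independent. -/
def IndepF (sim : F → F → Prop) (I : Finset F) : Prop :=
  ∀ f ∈ I, ∀ g ∈ I, f ≠ g → ¬ sim f g

/-- `B` is a partition of the word `W` into consecutive nonempty blocks of distinct,
pairwise non-neighbouring flaws, with each block contained in `Γ⁺` of the previous one. -/
def StablePartition (sim : F → F → Prop) (B : List (List F)) (W : List F) : Prop :=
  W = B.flatten ∧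
  (∀ b ∈ B, b ≠ [] ∧ b.Nodup ∧ b.Pairwise fun f g => ¬ sim f g) ∧
  B.Chain' fun b₁ b₂ => ∀ g ∈ b₂, ∃ f ∈ b₁, f = g ∨ sim f g

/-- A stable word. -/
def StableWord (sim : F → F → Prop) (W : List F) : Prop := ∃ B, StablePartition sim B W

/-- A stable partition whose blocks are listed in strictly increasing order. -/
def PiStablePartition [LinearOrder F] (sim : F → F → Prop) (B : List (List F))
    (W : List F) : Prop :=
  StablePartition sim B W ∧ ∀ b ∈ B, b.Chain' (· < ·)

/-- A π-stable word. -/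
def PiStableWord [LinearOrder F] (sim : F → F → Prop) (W : List F) : Prop :=
  ∃ B, PiStablePartition sim B W

/-- A deterministic strategy: it assigns to every walk whose final state is flawed
a flaw present in the final state. -/
def IsStrategy (S : Setup Ω F) (Λ : Walk Ω F → F) : Prop :=
  ∀ τ : Walk Ω F, Walk.Valid S.step τ → (∃ f, S.mem f (Walk.final τ)) →
    S.mem (Λ τ) (Walk.final τ)

/-- A walk follows the strategy `Λ`. -/
def Follows (Λ : Walk Ω F → F) (τ : Walk Ω F) : Prop :=
  ∀ (i : ℕ) (h : i < τ.steps.length),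
    (τ.steps.get ⟨i, h⟩).1 = Λ ⟨τ.start, τ.steps.take i⟩

/-- The set `Bad(t)` of bad `t`-trajectories. -/
def Bad (S : Setup Ω F) (Λ : Walk Ω F → F) (ωinit : Ω → ℝ) (t : ℕ) : Set (Walk Ω F) :=
  {τ | Walk.Valid S.step τ ∧ Walk.len τ = t ∧ Follows Λ τ ∧ 0 < ωinit τ.start}

/-- The cluster-expansion condition:
`(λ_f/μ_f) ∑_{S ∈ Ind(Γ(f))} μ(S) ≤ θ` for every flaw `f`. -/
def ClusterCond [Fintype F] (sim : F → F → Prop) (lam μ : F → ℝ) (θ : ℝ) : Prop :=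
  ∀ f : F,
    lam f / μ f *
      ∑ I ∈ Finset.univ.filter (fun I : Finset F => (∀ g ∈ I, sim f g) ∧ IndepF sim I),
        ∏ g ∈ I, μ g ≤ θ

/-- `τ` is a prefix of `τ'`. -/
def Walk.IsPrefix (τ τ' : Walk Ω F) : Prop := τ.start = τ'.start ∧ τ.steps <+: τ'.steps

/-- A valid set of walks: all walks follow one common deterministic strategy,
and no walk is a proper prefix of another one. -/
def ValidSet (S : Setup Ω F) (X : Set (Walk Ω F)) : Prop :=
  (∀ τ ∈ X, Walk.Valid S.step τ) ∧
  (∃ Λ : Walk Ω F → F, IsStrategy S Λ ∧ ∀ τ ∈ X, Follows Λ τ) ∧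
  ∀ τ ∈ X, ∀ τ' ∈ X, Walk.IsPrefix τ τ' → τ = τ'

/-- Atomicity of the resampling oracles. -/
def Atomic (S : Setup Ω F) : Prop :=
  ∀ f σ' σ₁ σ₂, S.step f σ₁ σ' → S.step f σ₂ σ' → σ₁ = σ₂

/-- The map `swap` sends every swappable pair of steps to a valid pair of steps. -/
def SwapValid (S : Setup Ω F) (sim : F → F → Prop) (swap : Ω → F → Ω → F → Ω → Ω) : Prop :=
  ∀ σ₁ f σ₂ g σ₃, S.step f σ₁ σ₂ → S.step g σ₂ σ₃ → ¬ sim f g →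
    S.step g σ₁ (swap σ₁ f σ₂ g σ₃) ∧ S.step f (swap σ₁ f σ₂ g σ₃) σ₃

/-- The map `swap` is injective (as a map of two-step walks). -/
def SwapInj (S : Setup Ω F) (sim : F → F → Prop) (swap : Ω → F → Ω → F → Ω → Ω) : Prop :=
  ∀ σ₁ f σ₂ τ₂ g σ₃, S.step f σ₁ σ₂ → S.step g σ₂ σ₃ → S.step f σ₁ τ₂ → S.step g τ₂ σ₃ →
    ¬ sim f g → swap σ₁ f σ₂ g σ₃ = swap σ₁ f τ₂ g σ₃ → σ₂ = τ₂

/-- The map `swap` preserves the product of the two transition probabilities. -/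
def SwapProb (S : Setup Ω F) (sim : F → F → Prop) (swap : Ω → F → Ω → F → Ω → Ω) : Prop :=
  ∀ σ₁ f σ₂ g σ₃, S.step f σ₁ σ₂ → S.step g σ₂ σ₃ → ¬ sim f g →
    S.ρ f σ₁ σ₂ * S.ρ g σ₂ σ₃ =
      S.ρ g σ₁ (swap σ₁ f σ₂ g σ₃) * S.ρ f (swap σ₁ f σ₂ g σ₃) σ₃

/-- `(ρ, ∼)` is weakly commutative. -/
def WeakComm (S : Setup Ω F) (sim : F → F → Prop) : Prop :=
  ∃ swap, SwapValid S sim swap ∧ SwapInj S sim swap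

/-- `(ρ, ∼)` is strongly commutative. -/
def StrongComm (S : Setup Ω F) (sim : F → F → Prop) : Prop :=
  ∃ swap, SwapValid S sim swap ∧ SwapInj S sim swap ∧ SwapProb S sim swap

/-- One valid swap transforming the walk `τ` into the walk `τ'`. -/
def SwapStep (S : Setup Ω F) (sim : F → F → Prop) (swap : Ω → F → Ω → F → Ω → Ω)
    (τ τ' : Walk Ω F) : Prop :=
  ∃ (A B : List (F × Ω)) (f g : F) (σ₂ σ₃ : Ω),
    f ≠ g ∧ ¬ sim f g ∧
    S.step f (endOf τ.start A) σ₂ ∧ S.step g σ₂ σ₃ ∧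
    τ.steps = A ++ (f, σ₂) :: (g, σ₃) :: B ∧
    τ' = ⟨τ.start, A ++ (g, swap (endOf τ.start A) f σ₂ g σ₃) :: (f, σ₃) :: B⟩

/-- `U` is a chain of the walk `τ`. -/
def IsChainOf (sim : F → F → Prop) (U : List F) (τ : Walk Ω F) : Prop :=
  U.Sublist (Walk.word τ) ∧ U.Chain' fun a b => a = b ∨ sim a b

/-- The longest prefix of `W` ending with `f` (empty if `f` does not occur in `W`). -/
def prefEnd (f : F) (W : List F) : List F :=
  (W.reverse.dropWhile fun x => decide (x ≠ f)).reverse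

/-- `W^f_τ` for `f ∈ F ∪ {∅}`. -/
def prefOpt (fo : Option F) (W : List F) : List F :=
  match fo with
  | none => W
  | some f => prefEnd f W

/-- `g ∈ Γ⁺(I)` for a list `I` of flaws. -/
def GammaPlusL (sim : F → F → Prop) (I : List F) (g : F) : Prop := ∃ f ∈ I, f = g ∨ sim f g

/-- The steps of one round, starting at state `σ` with already-addressed flaws `I`:
each addressed flaw `f` satisfies `f ∈ F_σ − Γ⁺(I)` and the step is valid. -/
def RoundFrom (S : Setup Ω F) (sim : F → F → Prop) : Ω → List F → List (F × Ω) → Prop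
  | _, _, [] => True
  | σ, I, (f, σ') :: rest =>
      S.mem f σ ∧ ¬ GammaPlusL sim I f ∧ σ' ∈ S.Act f σ ∧
      RoundFrom S sim σ' (I ++ [f]) rest

/-- Like `RoundFrom`, but the addressed flaw is moreover the `≼`-least of `F_σ − Γ⁺(I)`. -/
def RoundFromPi [LinearOrder F] (S : Setup Ω F) (sim : F → F → Prop) :
    Ω → List F → List (F × Ω) → Prop
  | _, _, [] => True
  | σ, I, (f, σ') :: rest =>
      S.mem f σ ∧ ¬ GammaPlusL sim I f ∧
      (∀ g, S.mem g σ → ¬ GammaPlusL sim I g → f ≤ g) ∧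
      σ' ∈ S.Act f σ ∧ RoundFromPi S sim σ' (I ++ [f]) rest

/-- A walk grouped into rounds: each round is valid, and at the final state of every
round except possibly the last one, `F_σ − Γ⁺(I_r) = ∅`. -/
def RoundsFrom (S : Setup Ω F) (sim : F → F → Prop) : Ω → List (List (F × Ω)) → Prop
  | _, [] => True
  | σ, b :: rest =>
      RoundFrom S sim σ [] b ∧
      (rest = [] ∨
        ((∀ g, S.mem g (endOf σ b) → GammaPlusL sim (b.map Prod.fst) g) ∧
          RoundsFrom S sim (endOf σ b) rest))

/-- Like `RoundsFrom`, with the `≼`-least flaw selection rule. -/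
def RoundsFromPi [LinearOrder F] (S : Setup Ω F) (sim : F → F → Prop) :
    Ω → List (List (F × Ω)) → Prop
  | _, [] => True
  | σ, b :: rest =>
      RoundFromPi S sim σ [] b ∧
      (rest = [] ∨
        ((∀ g, S.mem g (endOf σ b) → GammaPlusL sim (b.map Prod.fst) g) ∧
          RoundsFromPi S sim (endOf σ b) rest))

/-- The family `Ind^init = ∪_{σ : ωinit σ > 0} Ind(F_σ)`. -/
def indInitSets [Fintype F] (S : Setup Ω F) (sim : F → F → Prop) (ωinit : Ω → ℝ) :
    Finset (Finset F) :=
  Finset.univ.filter fun R => IndepF sim R ∧ ∃ σ, 0 < ωinit σ ∧ ∀ f ∈ R, S.mem f σ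

/-- `λ_φ` for a sequence of sets of flaws. -/
def seqWt (lam : F → ℝ) (φ : List (Finset F)) : ℝ := (φ.map fun I => ∏ f ∈ I, lam f).prod

/-- `|φ| = ∑_r |I_r|`. -/
def seqSize (φ : List (Finset F)) : ℕ := (φ.map Finset.card).sum

/-- A strongly stable sequence. -/
def StronglyStableSeq (sim : F → F → Prop) (φ : List (Finset F)) : Prop :=
  φ ≠ [] ∧ (∀ I ∈ φ, IndepF sim I) ∧
  φ.Chain' (fun I J => ∀ g ∈ J, ∃ f ∈ I, sim f g) ∧
  ∀ I ∈ φ.tail, I ≠ ∅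

/-- Membership in `Stab(R,S,t,ℓ)`. -/
def StabRSTL (sim : F → F → Prop) (R S : Finset F) (t ℓ : ℕ) (φ : List (Finset F)) : Prop :=
  φ.head? = some R ∧ φ.length ≤ ℓ ∧ t ≤ seqSize φ ∧
  ((φ.length = 1 ∧ S = ∅) ∨
    (2 ≤ φ.length ∧ S = φ.tail.headI.filter (fun g => ¬ ∃ f ∈ R, sim f g) ∧
      StronglyStableSeq sim φ.tail))

/-- One valid swap on words. -/
def WordSwap (sim : F → F → Prop) (W W' : List F) : Prop :=
  ∃ (A B : List F) (f g : F), f ≠ g ∧ ¬ sim f g ∧ W = A ++ f :: g :: B ∧ W' = A ++ g :: f :: B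

end LLLFormal

namespace LLLFormal

section Rearrangement

variable {Ω F : Type*}

section Blocks

variable [LinearOrder F] {sim : F → F → Prop}

/-- A nonempty independent block listed in strictly increasing order. -/
def SortedBlock (sim : F → F → Prop) (b : List F) : Prop :=
  b ≠ [] ∧ b.Pairwise fun f g => f < g ∧ ¬ sim f g

lemma piStablePartition_nil : PiStablePartition sim [] [] := by
  refine ⟨⟨rfl, by simp, ?_⟩, by simp⟩
  exact List.isChain_nil

lemma piStablePartition_cons (b : List F) (B : List (List F)) :
    PiStablePartition sim (b :: B) (b :: B).flatten ↔
      SortedBlock sim b ∧ (∀ b' ∈ B.head?, ∀ g ∈ b', GammaPlusL sim b g) ∧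
        PiStablePartition sim B B.flatten := by
  simp only [PiStablePartition, StablePartition, SortedBlock, GammaPlusL, List.Chain',
    List.isChain_cons, List.forall_mem_cons, List.isChain_iff_pairwise, true_and]
  constructor
  · rintro ⟨⟨⟨⟨h1, -, h2⟩, h3⟩, h4, h5⟩, h6, h7⟩
    exact ⟨⟨h1, List.Pairwise.and h6 h2⟩, h4, ⟨h3, h5⟩, h7⟩
  · rintro ⟨⟨h1, h2⟩, h4, ⟨h3, h5⟩, h7⟩
    exact ⟨⟨⟨⟨h1, h2.imp fun h => h.1.ne, h2.imp fun h => h.2⟩, h3⟩, h4, h5⟩,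
      h2.imp fun h => h.1, h7⟩

lemma sortedBlock_singleton (x : F) : SortedBlock sim [x] := by simp [SortedBlock]

lemma piStablePartition_singleton (x : F) : PiStablePartition sim [[x]] [x] :=
  (piStablePartition_cons [x] []).2 ⟨sortedBlock_singleton x, by simp, piStablePartition_nil⟩

/-- A flaw that commutes with a sorted block can be inserted into it. -/
lemma SortedBlock.exists_insert (hsym : Symmetric sim) {b : List F} (hb : SortedBlock sim b)
    {x : F} (hx : ∀ y ∈ b, x ≠ y ∧ ¬ sim x y) :
    ∃ P Q, b = P ++ Q ∧ SortedBlock sim (P ++ x :: Q) := by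
  suffices h : ∃ P Q, b = P ++ Q ∧ (P ++ x :: Q).Pairwise fun f g => f < g ∧ ¬ sim f g by
    obtain ⟨P, Q, h1, h2⟩ := h
    exact ⟨P, Q, h1, by simp, h2⟩
  replace hb := hb.2
  induction b with
  | nil => exact ⟨[], [], rfl, by simp⟩
  | cons a b ih =>
    rw [List.pairwise_cons] at hb
    obtain ⟨hxa, hx'⟩ := List.forall_mem_cons.1 hx
    rcases lt_or_gt_of_ne hxa.1 with h | h
    · refine ⟨[], a :: b, rfl, ?_⟩
      refine List.pairwise_cons.2 ⟨fun y hy => ⟨?_, (hx y hy).2⟩, List.pairwise_cons.2 hb⟩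
      rcases List.mem_cons.1 hy with rfl | hy
      · exact h
      · exact h.trans (hb.1 y hy).1
    · obtain ⟨P, Q, rfl, hPQ⟩ := ih hx' hb.2
      refine ⟨a :: P, Q, rfl, List.pairwise_cons.2 ⟨fun y hy => ?_, hPQ⟩⟩
      rcases List.mem_append.1 hy with hy | hy
      · exact hb.1 y (List.mem_append_left _ hy)
      · rcases List.mem_cons.1 hy with rfl | hy
        · exact ⟨h, fun hs => hxa.2 (hsym hs)⟩
        · exact hb.1 y (List.mem_append_right _ hy)

/-- A flaw commuting with a whole π-stable word can be inserted into the first block. -/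
lemma exists_insert_of_commute (hsym : Symmetric sim) {b : List F} {B : List (List F)}
    (hB : PiStablePartition sim (b :: B) (b :: B).flatten) {x : F}
    (hx : ∀ y ∈ (b :: B).flatten, x ≠ y ∧ ¬ sim x y) :
    ∃ P Q, b = P ++ Q ∧
      PiStablePartition sim ((P ++ x :: Q) :: B) ((P ++ x :: Q) :: B).flatten := by
  rw [piStablePartition_cons] at hB
  obtain ⟨P, Q, rfl, hPQ⟩ := hB.1.exists_insert hsym
    (fun y hy => hx y (by rw [List.flatten_cons]; exact List.mem_append_left _ hy))
  refine ⟨P, Q, rfl, (piStablePartition_cons _ _).2 ⟨hPQ, fun b' hb' g hg => ?_, hB.2.2⟩⟩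
  obtain ⟨f, hf, hfg⟩ := hB.2.1 b' hb' g hg
  exact ⟨f, by simp only [List.mem_append, List.mem_cons] at hf ⊢; tauto, hfg⟩

/-- A flaw that interacts with a π-stable word can be inserted into it, commuting only with
the flaws after it, so that the word stays π-stable with the same first block. -/
lemma exists_insert_of_gammaPlusL (hsym : Symmetric sim) (B : List (List F))
    (hB : PiStablePartition sim B B.flatten) {x : F} (hx : GammaPlusL sim B.flatten x) :
    ∃ P Q B', B.flatten = P ++ Q ∧ (∀ y ∈ Q, x ≠ y ∧ ¬ sim x y) ∧
      PiStablePartition sim B' (P ++ x :: Q) ∧ B'.head? = B.head? := by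
  induction B with
  | nil => obtain ⟨f, hf, -⟩ := hx; simp at hf
  | cons b B ih =>
    rw [piStablePartition_cons] at hB
    by_cases hx' : GammaPlusL sim B.flatten x
    · obtain ⟨P, Q, B', h1, h2, h3, h4⟩ := ih hB.2.2 hx'
      have h5 := h3.1.1
      refine ⟨b ++ P, Q, b :: B', by simp [h1], h2, ?_, rfl⟩
      have : b ++ P ++ x :: Q = (b :: B').flatten := by simp [← h5]
      rw [this, piStablePartition_cons]
      exact ⟨hB.1, by rw [h4]; exact hB.2.1, by rw [← h5]; exact h3⟩
    · have hcomm : ∀ y ∈ B.flatten, x ≠ y ∧ ¬ sim x y := fun y hy =>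
        ⟨fun h => hx' ⟨y, hy, Or.inl h.symm⟩, fun h => hx' ⟨y, hy, Or.inr (hsym h)⟩⟩
      have hxb : GammaPlusL sim b x := by
        obtain ⟨f, hf, hfx⟩ := hx
        rw [List.flatten_cons, List.mem_append] at hf
        exact hf.elim (fun h => ⟨f, h, hfx⟩) fun h => (hx' ⟨f, h, hfx⟩).elim
      cases B with
      | nil =>
        refine ⟨b, [], [b, [x]], by simp, by simp, ?_, rfl⟩
        have : b ++ [x] = [b, [x]].flatten := by simp
        rw [this, piStablePartition_cons]
        exact ⟨hB.1, by simpa using hxb, piStablePartition_singleton x⟩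
      | cons c B =>
        obtain ⟨P, Q, rfl, hPQ⟩ := exists_insert_of_commute hsym hB.2.2 hcomm
        refine ⟨b ++ P, Q ++ B.flatten, b :: (P ++ x :: Q) :: B, by simp, ?_, ?_, rfl⟩
        · intro y hy
          apply hcomm
          simp only [List.flatten_cons, List.mem_append] at hy ⊢
          tauto
        · have : b ++ P ++ x :: (Q ++ B.flatten) = (b :: (P ++ x :: Q) :: B).flatten := by simp
          rw [this, piStablePartition_cons]
          refine ⟨hB.1, ?_, hPQ⟩
          have := hB.2.1
          simp only [List.head?_cons, Option.mem_def, Option.some.injEq, forall_eq',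
            List.mem_append, List.mem_cons] at this ⊢
          rintro g (hg | rfl | hg)
          · exact this g (Or.inl hg)
          · exact hxb
          · exact this g (Or.inr hg)

/-- The reverse of `V` is π-stable, with root `{f}` when `fo = some f` and `V` is nonempty. -/
def IsCore (sim : F → F → Prop) (fo : Option F) (V : List F) : Prop :=
  ∃ B, PiStablePartition sim B V.reverse ∧ ∀ f, fo = some f → V ≠ [] → B.head? = some [f]

/-- The flaw `x`, addressed before the core `V`, belongs to the core. -/
def Extends (sim : F → F → Prop) (fo : Option F) (x : F) (V : List F) : Prop :=
  fo = none ∨ (V = [] ∧ fo = some x) ∨ GammaPlusL sim V x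

/-- Moving `x` past the first `j` flaws of `V` is legal and brings it to its place. -/
def IsJump (sim : F → F → Prop) (fo : Option F) (x : F) (V : List F) (j : ℕ) : Prop :=
  j ≤ V.length ∧ (∀ y ∈ V.take j, x ≠ y ∧ ¬ sim x y) ∧
    if Extends sim fo x V then IsCore sim fo (V.take j ++ x :: V.drop j) else j = V.length

lemma isCore_nil (fo : Option F) : IsCore sim fo [] :=
  ⟨[], piStablePartition_nil, by simp⟩

lemma isJump_of_append {fo : Option F} {x : F} {P Q : List F} (h : ∀ y ∈ P, x ≠ y ∧ ¬ sim x y)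
    (hE : Extends sim fo x (P ++ Q)) (hc : IsCore sim fo (P ++ x :: Q)) :
    IsJump sim fo x (P ++ Q) P.length := by
  refine ⟨by simp, by simpa using h, ?_⟩
  rw [if_pos hE]
  simpa using hc

lemma exists_isJump (hsym : Symmetric sim) (fo : Option F) (x : F) {V : List F}
    (hV : IsCore sim fo V) : ∃ j, IsJump sim fo x V j := by
  obtain ⟨B, hB, hroot⟩ := hV
  have hflat : V.reverse = B.flatten := hB.1.1
  by_cases hE : Extends sim fo x V
  · by_cases hG : GammaPlusL sim V x
    · obtain ⟨P, Q, B', h1, h2, h3, h4⟩ := exists_insert_of_gammaPlusL hsym B (hflat ▸ hB)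
        (x := x) (by rw [← hflat]; obtain ⟨f, hf, h⟩ := hG; exact ⟨f, by simpa using hf, h⟩)
      have hVe : V = Q.reverse ++ P.reverse := by
        rw [← List.reverse_append, ← h1, ← hflat, List.reverse_reverse]
      subst hVe
      refine ⟨_, isJump_of_append (by simpa using h2) hE ⟨B', by simpa using h3, ?_⟩⟩
      intro f hf _
      rw [h4]
      refine hroot f hf fun h => ?_
      obtain ⟨g, hg, -⟩ := hG
      simp [h] at hg
    · have hcomm : ∀ y ∈ V, x ≠ y ∧ ¬ sim x y := fun y hy =>
        ⟨fun h => hG ⟨y, hy, Or.inl h.symm⟩, fun h => hG ⟨y, hy, Or.inr (hsym h)⟩⟩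
      cases B with
      | nil =>
        obtain rfl : V = [] := by simpa using hflat
        refine ⟨_, isJump_of_append (P := []) (Q := []) (by simp) hE ⟨[[x]], ?_, ?_⟩⟩
        · exact piStablePartition_singleton x
        · rintro f rfl -
          rcases hE with h | ⟨-, h⟩ | h
          · simp at h
          · simpa using h.symm
          · exact (hG h).elim
      | cons b B =>
        have hne : V ≠ [] := by
          rintro rfl
          have := (((piStablePartition_cons b B).1 (hflat ▸ hB)).1).1
          simp_all
        have hfo : fo = none := by
          rcases hE with h | ⟨h, -⟩ | h
          · exact h
          · exact (hne h).elim
          · exact (hG h).elim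
        obtain ⟨P, Q, rfl, hPQ⟩ := exists_insert_of_commute hsym (hflat ▸ hB) (x := x)
          (by rw [← hflat]; simpa using hcomm)
        have hVe : V = (Q ++ B.flatten).reverse ++ P.reverse := by
          rw [← List.reverse_append, ← List.reverse_reverse V, hflat]; simp
        subst hVe
        refine ⟨_, isJump_of_append (fun y hy => hcomm y (List.mem_append_left _ hy)) hE
          ⟨_, by simpa using hPQ, by simp [hfo]⟩⟩
  · refine ⟨V.length, le_rfl, fun y hy => ?_, by rw [if_neg hE]⟩
    rw [List.take_length] at hy
    exact ⟨fun h => hE (Or.inr (Or.inr ⟨y, hy, Or.inl h.symm⟩)),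
      fun h => hE (Or.inr (Or.inr ⟨y, hy, Or.inr (hsym h)⟩))⟩

/-- The number of flaws of the core `V` past which a preceding flaw `x` is moved. -/
def jump (sim : F → F → Prop) (fo : Option F) (x : F) (V : List F) : ℕ :=
  Classical.epsilon (IsJump sim fo x V)

lemma isJump_jump (hsym : Symmetric sim) (fo : Option F) (x : F) {V : List F}
    (hV : IsCore sim fo V) : IsJump sim fo x V (jump sim fo x V) :=
  Classical.epsilon_spec (exists_isJump hsym fo x hV)

/-- The flaws of a word on which the last occurrence of `f` depends (all flaws if
`fo = none`), listed so that the reverse is π-stable. -/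
def core (sim : F → F → Prop) (fo : Option F) : List F → List F
  | [] => []
  | x :: w =>
    let V := core sim fo w
    if Extends sim fo x V then
      V.take (jump sim fo x V) ++ x :: V.drop (jump sim fo x V)
    else V

lemma isCore_core (hsym : Symmetric sim) (fo : Option F) (w : List F) :
    IsCore sim fo (core sim fo w) := by
  induction w with
  | nil => exact isCore_nil fo
  | cons x w ih =>
    have h := (isJump_jump hsym fo x ih).2.2
    rw [core]
    split_ifs at h ⊢
    · exact h
    · exact ih

lemma core_ne_nil {f : F} {w : List F} (hf : f ∈ w) : core sim (some f) w ≠ [] := by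
  induction w with
  | nil => simp at hf
  | cons x w ih =>
    rw [core]
    split_ifs with hE
    · simp
    · rcases List.mem_cons.1 hf with rfl | h
      · exact fun h => hE (Or.inr (Or.inl ⟨h, rfl⟩))
      · exact ih h

lemma core_eq_erase (hsym : Symmetric sim) (fo : Option F) (x : F) (w : List F) :
    core sim fo w = (core sim fo (x :: w)).erase x := by
  have h := isJump_jump hsym fo x (isCore_core hsym fo w)
  rw [core]
  split_ifs with hE
  · rw [List.erase_append_right _ (fun hx => (h.2.1 x hx).1 rfl)]
    simp
  · rw [List.erase_of_not_mem fun hx => hE (Or.inr (Or.inr ⟨x, hx, Or.inl rfl⟩))]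

lemma core_eq_of_cons (hsym : Symmetric sim) {fo : Option F} {x : F} {v w : List F}
    (h : core sim fo (x :: v) = core sim fo (x :: w)) : core sim fo v = core sim fo w := by
  rw [core_eq_erase hsym fo x v, h, ← core_eq_erase hsym fo x w]

lemma IsCore.getLast?_eq {f : F} {V : List F} (hV : IsCore sim (some f) V) (hne : V ≠ []) :
    V.getLast? = some f := by
  obtain ⟨B, hB, hroot⟩ := hV
  have hf := hroot f rfl hne
  cases B with
  | nil => simp at hf
  | cons b B =>
    obtain rfl : b = [f] := by simpa using hf
    have := hB.1.1
    rw [← List.head?_reverse, this]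
    simp

end Blocks

lemma prefEnd_append {f : F} {V R : List F} (hV : V ≠ [] → V.getLast? = some f) (hR : f ∉ R) :
    prefEnd f (V ++ R) = V := by
  have h1 : R.reverse.dropWhile (fun x => decide (x ≠ f)) = [] := by
    rw [List.dropWhile_eq_nil_iff]
    intro x hx
    have : x ≠ f := by rintro rfl; exact hR (List.mem_reverse.1 hx)
    simpa using this
  have h2 : V.reverse.dropWhile (fun x => decide (x ≠ f)) = V.reverse := by
    by_cases hne : V = []
    · simp [hne]
    · have h := hV hne
      rw [← List.head?_reverse] at h
      cases hr : V.reverse with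
      | nil => rfl
      | cons a l =>
        rw [hr] at h
        obtain rfl : a = f := by simpa using h
        simp
  rw [prefEnd, List.reverse_append, List.dropWhile_append, h1, h2]
  simp

/-- Move the first step `(x, s)` of a walk past the first `j` steps of the remaining walk. -/
def moveRight (swap : Ω → F → Ω → F → Ω → Ω) :
    Ω → F → Ω → ℕ → List (F × Ω) → List (F × Ω)
  | _, x, s, 0, m => (x, s) :: m
  | _, x, s, _ + 1, [] => [(x, s)]
  | σ, x, s, j + 1, (y, t) :: m =>
    (y, swap σ x s y t) :: moveRight swap (swap σ x s y t) x t j m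

lemma word_moveRight (swap : Ω → F → Ω → F → Ω → Ω) (σ : Ω) (x : F) (s : Ω) (j : ℕ)
    (m : List (F × Ω)) :
    (moveRight swap σ x s j m).map Prod.fst =
      (m.map Prod.fst).take j ++ x :: (m.map Prod.fst).drop j := by
  induction j generalizing σ s m with
  | zero => simp [moveRight]
  | succ j ih =>
    cases m with
    | nil => simp [moveRight]
    | cons a m => simp [moveRight, ih]

section Arrange

variable [LinearOrder F] {sim : F → F → Prop}

/-- Rearrange a walk by swaps so that its flaw word starts with its core. -/
def arrange (sim : F → F → Prop) (swap : Ω → F → Ω → F → Ω → Ω) (fo : Option F) :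
    Ω → List (F × Ω) → List (F × Ω)
  | _, [] => []
  | σ, (x, s) :: l =>
    moveRight swap σ x s (jump sim fo x (core sim fo (l.map Prod.fst)))
      (arrange sim swap fo s l)

lemma word_arrange (hsym : Symmetric sim) (swap : Ω → F → Ω → F → Ω → Ω) (fo : Option F) (σ : Ω)
    (l : List (F × Ω)) :
    ∃ R, (arrange sim swap fo σ l).map Prod.fst = core sim fo (l.map Prod.fst) ++ R ∧
      (fo = none → R = []) ∧ ∀ f, fo = some f → f ∉ R := by
  induction l generalizing σ with
  | nil => exact ⟨[], by simp [arrange, core]⟩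
  | cons a l ih =>
    obtain ⟨x, s⟩ := a
    obtain ⟨R, h1, h2, h3⟩ := ih s
    have hcore := isCore_core hsym fo (l.map Prod.fst)
    have hj := isJump_jump hsym fo x hcore
    rw [arrange, word_moveRight, h1, List.map_cons, core]
    rw [List.take_append_of_le_length hj.1, List.drop_append_of_le_length hj.1]
    split_ifs with hE
    · exact ⟨R, by simp, h2, h3⟩
    · have hjl := hj.2.2
      rw [if_neg hE] at hjl
      rw [hjl]
      refine ⟨x :: R, by simp, fun h => (hE (Or.inl h)).elim, ?_⟩
      rintro f rfl hfR
      rcases List.mem_cons.1 hfR with rfl | h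
      · by_cases hne : core sim (some f) (l.map Prod.fst) = []
        · exact hE (Or.inr (Or.inl ⟨hne, rfl⟩))
        · exact hE (Or.inr (Or.inr ⟨f, List.mem_of_getLast? (hcore.getLast?_eq hne), Or.inl rfl⟩))
      · exact h3 f rfl h

lemma take_jump_word_arrange (hsym : Symmetric sim) (swap : Ω → F → Ω → F → Ω → Ω)
    (fo : Option F) (σ : Ω) (x : F) (l : List (F × Ω)) :
    ((arrange sim swap fo σ l).map Prod.fst).take
        (jump sim fo x (core sim fo (l.map Prod.fst))) =
      (core sim fo (l.map Prod.fst)).take (jump sim fo x (core sim fo (l.map Prod.fst))) := by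
  obtain ⟨R, h, -⟩ := word_arrange hsym swap fo σ l
  rw [h, List.take_append_of_le_length (isJump_jump hsym fo x (isCore_core hsym fo _)).1]

lemma commute_take_jump_arrange (hsym : Symmetric sim) (swap : Ω → F → Ω → F → Ω → Ω)
    (fo : Option F) (σ : Ω) (x : F) (l : List (F × Ω)) :
    ∀ y ∈ ((arrange sim swap fo σ l).map Prod.fst).take
        (jump sim fo x (core sim fo (l.map Prod.fst))), x ≠ y ∧ ¬ sim x y := by
  rw [take_jump_word_arrange hsym]
  exact (isJump_jump hsym fo x (isCore_core hsym fo _)).2.1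

lemma prefOpt_word_arrange (hsym : Symmetric sim) (swap : Ω → F → Ω → F → Ω → Ω) (fo : Option F)
    (σ : Ω) (l : List (F × Ω)) :
    prefOpt fo ((arrange sim swap fo σ l).map Prod.fst) = core sim fo (l.map Prod.fst) := by
  obtain ⟨R, h1, h2, h3⟩ := word_arrange hsym swap fo σ l
  rw [h1]
  cases fo with
  | none => simp [prefOpt, h2 rfl]
  | some f => exact prefEnd_append (isCore_core hsym _ _).getLast?_eq (h3 f rfl)

end Arrange

lemma endOf_concat (σ : Ω) (l : List (F × Ω)) (x : F) (s : Ω) : endOf σ (l ++ [(x, s)]) = s := by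
  simp [endOf]

/-- Two lists of steps that are equal, or first differ in a state reached. -/
inductive Branch : List (F × Ω) → List (F × Ω) → Prop
  | nil : Branch [] []
  | split (x : F) (s t : Ω) (l m : List (F × Ω)) : s ≠ t → Branch ((x, s) :: l) ((x, t) :: m)
  | cons (x : F) (s : Ω) (l m : List (F × Ω)) : Branch l m → Branch ((x, s) :: l) ((x, s) :: m)

lemma Branch.eq_of_prefix {l m : List (F × Ω)} (h : Branch l m) (hp : l <+: m) : l = m := by
  induction h with
  | nil => rfl
  | split x s t l m hst => simp [List.cons_prefix_cons, hst] at hp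
  | cons x s l m _ ih => rw [ih (List.cons_prefix_cons.1 hp).2]

lemma Branch.flaw_eq {A B C : List (F × Ω)} {g h : F} {s t : Ω}
    (hb : Branch (A ++ (g, s) :: B) (A ++ (h, t) :: C)) : g = h := by
  induction A with
  | nil => cases hb <;> rfl
  | cons a A ih =>
    apply ih
    rw [List.cons_append, List.cons_append] at hb
    cases hb with
    | split _ _ _ _ _ hst => exact (hst rfl).elim
    | cons _ _ _ _ h => exact h

lemma Branch.of_follows {Λ : Walk Ω F → F} {σ : Ω} (A l m : List (F × Ω))
    (hl : Follows Λ ⟨σ, A ++ l⟩) (hm : Follows Λ ⟨σ, A ++ m⟩)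
    (hlm : l <+: m → l = m) (hml : m <+: l → m = l) : Branch l m := by
  induction l generalizing A m with
  | nil => rw [← hlm (List.nil_prefix)]; exact .nil
  | cons a l ih =>
    cases m with
    | nil => cases hml List.nil_prefix
    | cons b m =>
      obtain ⟨x, s⟩ := a
      obtain ⟨y, t⟩ := b
      have h1 := hl A.length (by simp)
      have h2 := hm A.length (by simp)
      simp at h1 h2
      obtain rfl : x = y := h1.trans h2.symm
      by_cases hst : s = t
      · subst hst
        refine .cons _ _ _ _ (ih (A ++ [(x, s)]) m (by simpa using hl) (by simpa using hm) ?_ ?_)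
        · exact fun h => (List.cons.inj (hlm (List.cons_prefix_cons.2 ⟨rfl, h⟩))).2
        · exact fun h => (List.cons.inj (hml (List.cons_prefix_cons.2 ⟨rfl, h⟩))).2
      · exact .split _ _ _ _ _ hst

lemma ValidFrom.append_left {step : F → Ω → Ω → Prop} {σ : Ω} {A l : List (F × Ω)}
    (h : ValidFrom step σ (A ++ l)) : ValidFrom step σ A := by
  induction A generalizing σ with
  | nil => trivial
  | cons a A ih => exact ⟨h.1, ih h.2⟩

lemma endOf_cons (σ : Ω) (x : F) (s : Ω) (l : List (F × Ω)) :
    endOf σ ((x, s) :: l) = endOf s l := by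
  rw [endOf, List.map_cons, List.getLastD_cons, endOf]

lemma ValidFrom.step_of_append {step : F → Ω → Ω → Prop} {σ : Ω} {A l : List (F × Ω)} {x : F}
    {s : Ω} (h : ValidFrom step σ (A ++ (x, s) :: l)) : step x (endOf σ A) s := by
  induction A generalizing σ with
  | nil => exact h.1
  | cons a A ih => obtain ⟨y, t⟩ := a; rw [endOf_cons]; exact ih h.2

variable [Fintype Ω] {S : Setup Ω F} {sim : F → F → Prop} {swap : Ω → F → Ω → F → Ω → Ω}

/-- Valid walks that pairwise branch at a state form a valid set. -/
lemma ValidSet.of_branch {Λ₀ : Walk Ω F → F} (hΛ₀ : IsStrategy S Λ₀) {Y : Set (Walk Ω F)}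
    (hval : ∀ τ ∈ Y, Walk.Valid S.step τ)
    (hbr : ∀ τ ∈ Y, ∀ τ' ∈ Y, τ.start = τ'.start → Branch τ.steps τ'.steps) : ValidSet S Y := by
  let Next (τ : Walk Ω F) (g : F) : Prop :=
    ∃ s C, ∃ τ' ∈ Y, τ'.start = τ.start ∧ τ'.steps = τ.steps ++ (g, s) :: C
  let Λ : Walk Ω F → F := fun τ => if h : ∃ g, Next τ g then h.choose else Λ₀ τ
  refine ⟨hval, ⟨Λ, ?_, ?_⟩, ?_⟩
  · intro τ hτ hf
    by_cases h : ∃ g, Next τ g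
    · have hΛ : Λ τ = h.choose := dif_pos h
      rw [hΛ]
      obtain ⟨s, C, τ', hτ', h1, h2⟩ := h.choose_spec
      have hv := hval τ' hτ'
      rw [Walk.Valid, h1, h2] at hv
      exact hv.step_of_append.1
    · have hΛ : Λ τ = Λ₀ τ := dif_neg h
      rw [hΛ]
      exact hΛ₀ τ hτ hf
  · intro τ hτ i hi
    have hsplit : τ.steps = τ.steps.take i ++ τ.steps[i] :: τ.steps.drop (i + 1) := by simp
    have h : ∃ g, Next ⟨τ.start, τ.steps.take i⟩ g := ⟨_, _, _, τ, hτ, rfl, hsplit⟩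
    have hΛ : Λ ⟨τ.start, τ.steps.take i⟩ = h.choose := dif_pos h
    rw [hΛ]
    obtain ⟨s, C, τ', hτ', h1, h2⟩ := h.choose_spec
    have hb := hbr τ hτ τ' hτ' h1.symm
    rw [h2] at hb
    refine Branch.flaw_eq (A := τ.steps.take i) (B := τ.steps.drop (i + 1)) (C := C)
      (s := τ.steps[i].2) (t := s) ?_
    exact hsplit ▸ hb
  · rintro ⟨σ, l⟩ hτ ⟨σ', m⟩ hτ' ⟨rfl, hp⟩
    have := (hbr _ hτ _ hτ' rfl).eq_of_prefix hp
    simp only at this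
    rw [this]

lemma ValidFrom.moveRight (hsv : SwapValid S sim swap) {σ : Ω} {x : F} {s : Ω} {j : ℕ}
    {m : List (F × Ω)} (h : ValidFrom S.step σ ((x, s) :: m))
    (hc : ∀ y ∈ (m.map Prod.fst).take j, x ≠ y ∧ ¬ sim x y) :
    ValidFrom S.step σ (moveRight swap σ x s j m) := by
  induction j generalizing σ s m with
  | zero => exact h
  | succ j ih =>
    cases m with
    | nil => exact h
    | cons a m =>
      obtain ⟨y, t⟩ := a
      simp only [List.map_cons, List.take_succ_cons, List.forall_mem_cons] at hc
      have hs := hsv σ x s y t h.1 h.2.1 hc.1.2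
      exact ⟨hs.1, ih ⟨hs.2, h.2.2⟩ hc.2⟩

lemma swapSteps_moveRight (hsv : SwapValid S sim swap) (σ : Ω) (A : List (F × Ω)) {x : F} {s : Ω}
    {j : ℕ} {m : List (F × Ω)} (h : ValidFrom S.step (endOf σ A) ((x, s) :: m))
    (hc : ∀ y ∈ (m.map Prod.fst).take j, x ≠ y ∧ ¬ sim x y) :
    Relation.ReflTransGen (SwapStep S sim swap) ⟨σ, A ++ (x, s) :: m⟩
      ⟨σ, A ++ moveRight swap (endOf σ A) x s j m⟩ := by
  induction j generalizing A s m with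
  | zero => exact .refl
  | succ j ih =>
    cases m with
    | nil => exact .refl
    | cons a m =>
      obtain ⟨y, t⟩ := a
      simp only [List.map_cons, List.take_succ_cons, List.forall_mem_cons] at hc
      have hs := hsv _ x s y t h.1 h.2.1 hc.1.2
      refine .head ⟨A, m, x, y, s, t, hc.1.1, hc.1.2, h.1, h.2.1, rfl, rfl⟩ ?_
      have := ih (A ++ [(y, swap (endOf σ A) x s y t)]) (s := t) (m := m)
        (by rw [endOf_concat]; exact ⟨hs.2, h.2.2⟩) hc.2
      rw [endOf_concat] at this
      simpa [moveRight] using this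

/-- Moving a step to the right preserves branching and is injective. -/
lemma Branch.moveRight (hsi : SwapInj S sim swap) {σ : Ω} {x : F} {s₁ s₂ : Ω} {j : ℕ}
    {m₁ m₂ : List (F × Ω)} (h₁ : ValidFrom S.step σ ((x, s₁) :: m₁))
    (h₂ : ValidFrom S.step σ ((x, s₂) :: m₂)) (hsv : SwapValid S sim swap)
    (hw : (m₁.map Prod.fst).take j = (m₂.map Prod.fst).take j)
    (hc : ∀ y ∈ (m₁.map Prod.fst).take j, x ≠ y ∧ ¬ sim x y)
    (hb : Branch ((x, s₁) :: m₁) ((x, s₂) :: m₂)) :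
    Branch (moveRight swap σ x s₁ j m₁) (moveRight swap σ x s₂ j m₂) ∧
      (LLLFormal.moveRight swap σ x s₁ j m₁ = LLLFormal.moveRight swap σ x s₂ j m₂ →
        s₁ = s₂ ∧ m₁ = m₂) := by
  induction j generalizing σ s₁ s₂ m₁ m₂ with
  | zero => exact ⟨hb, by simp [LLLFormal.moveRight]⟩
  | succ j ih =>
    cases m₁ with
    | nil =>
      cases m₂ with
      | nil => exact ⟨hb, by simp [LLLFormal.moveRight]⟩
      | cons b m₂ => simp at hw
    | cons a m₁ =>
      cases m₂ with
      | nil => simp at hw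
      | cons b m₂ =>
        obtain ⟨y, t₁⟩ := a
        obtain ⟨z, t₂⟩ := b
        simp only [List.map_cons, List.take_succ_cons, List.cons.injEq,
          List.forall_mem_cons] at hc hw
        obtain ⟨rfl, hw⟩ := hw
        have hs₁ := hsv σ x s₁ y t₁ h₁.1 h₁.2.1 hc.1.2
        have hs₂ := hsv σ x s₂ y t₂ h₂.1 h₂.2.1 hc.1.2
        simp only [LLLFormal.moveRight]
        by_cases hu : swap σ x s₁ y t₁ = swap σ x s₂ y t₂
        · rw [← hu] at hs₂ ⊢
          have hb' : Branch ((x, t₁) :: m₁) ((x, t₂) :: m₂) := by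
            by_cases ht : t₁ = t₂
            · subst ht
              obtain rfl : s₁ = s₂ :=
                hsi σ x s₁ s₂ y t₁ h₁.1 h₁.2.1 h₂.1 h₂.2.1 hc.1.2 hu
              cases hb with
              | split _ _ _ _ _ h => exact (h rfl).elim
              | cons _ _ _ _ h =>
                cases h with
                | split _ _ _ _ _ h => exact (h rfl).elim
                | cons _ _ _ _ h => exact .cons _ _ _ _ h
            · exact .split _ _ _ _ _ ht
          obtain ⟨h3, h4⟩ := ih ⟨hs₁.2, h₁.2.2⟩ ⟨hs₂.2, h₂.2.2⟩ hw hc.2 hb'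
          refine ⟨.cons _ _ _ _ h3, fun h => ?_⟩
          obtain ⟨rfl, rfl⟩ := h4 (List.cons.inj h).2
          exact ⟨hsi σ x s₁ s₂ y t₁ h₁.1 h₁.2.1 h₂.1 h₂.2.1 hc.1.2 hu, rfl⟩
        · exact ⟨.split _ _ _ _ _ hu, fun h => by simp [hu] at h⟩

variable [LinearOrder F]

lemma ValidFrom.arrange (hsym : Symmetric sim) (hsv : SwapValid S sim swap) (fo : Option F)
    {σ : Ω} {l : List (F × Ω)} (h : ValidFrom S.step σ l) :
    ValidFrom S.step σ (arrange sim swap fo σ l) := by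
  induction l generalizing σ with
  | nil => trivial
  | cons a l ih =>
    exact ValidFrom.moveRight hsv ⟨h.1, ih h.2⟩ (commute_take_jump_arrange hsym swap fo _ _ l)

lemma swapSteps_arrange (hsym : Symmetric sim) (hsv : SwapValid S sim swap) (fo : Option F)
    (σ : Ω) (A : List (F × Ω)) {l : List (F × Ω)} (h : ValidFrom S.step (endOf σ A) l) :
    Relation.ReflTransGen (SwapStep S sim swap) ⟨σ, A ++ l⟩
      ⟨σ, A ++ arrange sim swap fo (endOf σ A) l⟩ := by
  induction l generalizing A with
  | nil => exact .refl
  | cons a l ih =>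
    obtain ⟨x, s⟩ := a
    have h1 := ih (A ++ [(x, s)]) (by rw [endOf_concat]; exact h.2)
    rw [endOf_concat] at h1
    simp only [List.append_assoc, List.singleton_append] at h1
    exact h1.trans (swapSteps_moveRight hsv σ A ⟨h.1, ValidFrom.arrange hsym hsv fo h.2⟩
      (commute_take_jump_arrange hsym swap fo _ _ l))

/-- Rearranging walks with equal cores preserves branching and is injective. -/
lemma Branch.arrange (hsym : Symmetric sim) (hsv : SwapValid S sim swap)
    (hsi : SwapInj S sim swap) (fo : Option F) {σ : Ω} {l m : List (F × Ω)} (hb : Branch l m)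
    (hl : ValidFrom S.step σ l) (hm : ValidFrom S.step σ m)
    (hc : core sim fo (l.map Prod.fst) = core sim fo (m.map Prod.fst)) :
    Branch (arrange sim swap fo σ l) (arrange sim swap fo σ m) ∧
      (LLLFormal.arrange sim swap fo σ l = LLLFormal.arrange sim swap fo σ m → l = m) := by
  induction hb generalizing σ with
  | nil => exact ⟨.nil, fun _ => rfl⟩
  | split x s t l m hst =>
    have hc' := core_eq_of_cons hsym hc
    simp only [LLLFormal.arrange]
    have hw := (take_jump_word_arrange hsym swap fo s x l)
    have hw' := (take_jump_word_arrange hsym swap fo t x m)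
    have hcm := commute_take_jump_arrange hsym swap fo s x l
    rw [← hc'] at hw' ⊢
    obtain ⟨h1, h2⟩ := Branch.moveRight hsi ⟨hl.1, ValidFrom.arrange hsym hsv fo hl.2⟩
      ⟨hm.1, ValidFrom.arrange hsym hsv fo hm.2⟩ hsv (hw.trans hw'.symm) hcm
      (.split _ _ _ _ _ hst)
    exact ⟨h1, fun h => (hst (h2 h).1).elim⟩
  | cons x s l m hb ih =>
    have hc' := core_eq_of_cons hsym hc
    simp only [LLLFormal.arrange]
    have hw := (take_jump_word_arrange hsym swap fo s x l)
    have hw' := (take_jump_word_arrange hsym swap fo s x m)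
    have hcm := commute_take_jump_arrange hsym swap fo s x l
    obtain ⟨h3, h4⟩ := ih hl.2 hm.2 hc'
    rw [← hc'] at hw' ⊢
    obtain ⟨h1, h2⟩ := Branch.moveRight hsi ⟨hl.1, ValidFrom.arrange hsym hsv fo hl.2⟩
      ⟨hm.1, ValidFrom.arrange hsym hsv fo hm.2⟩ hsv (hw.trans hw'.symm) hcm
      (.cons _ _ _ _ h3)
    exact ⟨h1, fun h => by rw [h4 (h2 h).2]⟩

end Rearrangement

/-- Theorem "ParSwapping": if `(ρ,∼)` is weakly commutative (witnessed by
`swap`) and `X` is a valid set of walks all containing `f ∈ F ∪ {∅}`, then there is a set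
`Xπ` and a bijection `Φ : X → Xπ` realized by valid swaps such that (a) for each
`τ ∈ Xπ`, the word `W = REV[W^f_τ]` is π-stable and lies in `Stab_π`, with root `{f}`
whenever `f ∈ F`, and (b) for every word `W` the set `{τ ∈ Xπ : REV[W^f_τ] = W}` is
valid. -/
theorem stmt_13 {Ω F : Type*} [Fintype Ω] [LinearOrder F]
    (S : Setup Ω F) (sim : F → F → Prop) (hsym : Symmetric sim)
    (swap : Ω → F → Ω → F → Ω → Ω)
    (hsv : SwapValid S sim swap) (hsi : SwapInj S sim swap)
    (fo : Option F) (X : Set (Walk Ω F)) (hX : ValidSet S X)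
    (hcont : ∀ τ ∈ X, ∀ f : F, fo = some f → f ∈ Walk.word τ) :
    ∃ (Xπ : Set (Walk Ω F)) (Φ : Walk Ω F → Walk Ω F),
      Set.BijOn Φ X Xπ ∧
      (∀ τ ∈ X, Relation.ReflTransGen (SwapStep S sim swap) τ (Φ τ)) ∧
      (∀ τ ∈ Xπ,
        PiStableWord sim (prefOpt fo (Walk.word τ)).reverse ∧
        (∃ τw : Walk Ω F, Walk.Valid S.step τw ∧
          (Walk.word τw = (prefOpt fo (Walk.word τ)).reverse ∨
            Walk.word τw = prefOpt fo (Walk.word τ))) ∧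
        (∀ f : F, fo = some f →
          ∃ B : List (List F),
            PiStablePartition sim B (prefOpt fo (Walk.word τ)).reverse ∧
            B.headI = [f])) ∧
      (∀ W : List F, ValidSet S {τ ∈ Xπ | (prefOpt fo (Walk.word τ)).reverse = W}) := by
  let Φ : Walk Ω F → Walk Ω F := fun τ => ⟨τ.start, arrange sim swap fo τ.start τ.steps⟩
  have hpref : ∀ τ, prefOpt fo (Walk.word (Φ τ)) = core sim fo (Walk.word τ) := fun τ =>
    prefOpt_word_arrange hsym swap fo τ.start τ.steps
  have hvalid : ∀ τ ∈ X, Walk.Valid S.step (Φ τ) := fun τ hτ =>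
    ValidFrom.arrange hsym hsv fo (hX.1 τ hτ)
  obtain ⟨Λ, hΛ, hfol⟩ := hX.2.1
  have hbranch : ∀ τ ∈ X, ∀ τ' ∈ X, τ.start = τ'.start → Branch τ.steps τ'.steps := by
    rintro ⟨σ, l⟩ hτ ⟨σ', m⟩ hτ' rfl
    refine Branch.of_follows [] l m (hfol _ hτ) (hfol _ hτ') (fun h => ?_) fun h => ?_
    · exact congrArg Walk.steps (hX.2.2 _ hτ _ hτ' ⟨rfl, h⟩)
    · exact congrArg Walk.steps (hX.2.2 _ hτ' _ hτ ⟨rfl, h⟩)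
  have harr : ∀ τ ∈ X, ∀ τ' ∈ X, τ.start = τ'.start →
      core sim fo (Walk.word τ) = core sim fo (Walk.word τ') →
      Branch (Φ τ).steps (Φ τ').steps ∧ ((Φ τ).steps = (Φ τ').steps → τ.steps = τ'.steps) := by
    rintro ⟨σ, l⟩ hτ ⟨σ', m⟩ hτ' rfl hc
    exact (hbranch _ hτ _ hτ' rfl).arrange hsym hsv hsi fo (hX.1 _ hτ) (hX.1 _ hτ') hc
  refine ⟨Φ '' X, Φ, ⟨Set.mapsTo_image Φ X, ?_, Set.surjOn_image Φ X⟩, ?_, ?_, ?_⟩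
  · intro τ hτ τ' hτ' h
    have hs : τ.start = τ'.start := congrArg (fun τ => τ.start) h
    have hc : core sim fo (Walk.word τ) = core sim fo (Walk.word τ') := by
      rw [← hpref, ← hpref, h]
    have hl := (harr τ hτ τ' hτ' hs hc).2 (congrArg Walk.steps h)
    cases τ
    cases τ'
    simp_all
  · intro τ hτ
    exact swapSteps_arrange hsym hsv fo τ.start [] (hX.1 τ hτ)
  · rintro _ ⟨τ, hτ, rfl⟩
    have hcore := isCore_core hsym fo (Walk.word τ)
    rw [hpref]
    refine ⟨?_, ?_, ?_⟩
    · obtain ⟨B, hB, -⟩ := hcore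
      exact ⟨B, hB⟩
    · obtain ⟨R, hR, -⟩ := word_arrange hsym swap fo τ.start τ.steps
      obtain ⟨A, C, hAC, hA, -⟩ := List.map_eq_append_iff.1 hR
      have hv := hvalid τ hτ
      rw [Walk.Valid, show (Φ τ).steps = A ++ C from hAC] at hv
      exact ⟨⟨τ.start, A⟩, hv.append_left, Or.inr hA⟩
    · rintro f rfl
      obtain ⟨B, hB, hroot⟩ := hcore
      have h := hroot f rfl (core_ne_nil (hcont τ hτ f rfl))
      refine ⟨B, hB, ?_⟩
      cases B with
      | nil => simp at h
      | cons b B => simpa using h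
  · intro W
    refine ValidSet.of_branch hΛ ?_ ?_
    · rintro _ ⟨⟨τ, hτ, rfl⟩, -⟩
      exact hvalid τ hτ
    · rintro _ ⟨⟨τ, hτ, rfl⟩, h⟩ _ ⟨⟨τ', hτ', rfl⟩, h'⟩ hs
      refine (harr τ hτ τ' hτ' hs ?_).1
      rw [hpref] at h h'
      exact List.reverse_injective (h.trans h'.symm)

end LLLFormal
end
end

section
/- Let G be a finite simple graph on an even number of vertices satisfying condition (*). Let σ be a perfect matching of G and let e_1, e_2 ∈ E(G) be vertex-disjoint edges. Then ψ̂(e_1, ψ̂(e_2, σ)) = ψ̂(e_2, ψ̂(e_1, σ)), and this common perfect matching contains both e_1 and e_2. -/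
open scoped Classical

noncomputable section

namespace PMFormal

variable {V : Type*}

/-- `σ` is a perfect matching of `G`: a set of edges of `G` such that every vertex
belongs to exactly one edge of `σ`. -/
def IsPM (G : SimpleGraph V) (σ : Set (Sym2 V)) : Prop :=
  σ ⊆ G.edgeSet ∧ ∀ v : V, ∃! e, e ∈ σ ∧ v ∈ e

/-- The vertex matched to `u` in `σ` (an arbitrary junk value if none exists). -/
def partner (σ : Set (Sym2 V)) (u : V) : V :=
  if h : ∃ w, s(u, w) ∈ σ then h.choose else u

/-- The resampling map `ψ̂({u,v}, σ)`: with `u' = partner σ u` and `v' = partner σ v`,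
`ψ̂({u,v},σ) = (σ − {{u,u'},{v,v'}}) ∪ {{u,v},{u',v'}}`. -/
def psiHat (σ : Set (Sym2 V)) (u v : V) : Set (Sym2 V) :=
  (σ \ {s(u, partner σ u), s(v, partner σ v)}) ∪ {s(u, v), s(partner σ u, partner σ v)}

/-- Condition (*): whenever `u', u, v, v'` are four distinct vertices forming a path
`u' - u - v - v'` in `G`, also `{u',v'}` is an edge of `G`. -/
def CondStar (G : SimpleGraph V) : Prop :=
  ∀ u' u v v' : V, u' ≠ u → u' ≠ v → u' ≠ v' → u ≠ v → u ≠ v' → v ≠ v' →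
    G.Adj u' u → G.Adj u v → G.Adj v v' → G.Adj u' v'

end PMFormal

namespace PMFormal

theorem IsPM.mem_iff {G : SimpleGraph V} {σ : Set (Sym2 V)} (h : IsPM G σ) (x y : V) :
    s(x, y) ∈ σ ↔ partner σ x = y := by
  obtain ⟨e, ⟨he, hxe⟩, huniq⟩ := h.2 x
  obtain ⟨z, rfl⟩ := Sym2.mem_iff_exists.mp hxe
  have hex : ∃ w, s(x, w) ∈ σ := ⟨z, he⟩
  have hunique : ∀ w, s(x, w) ∈ σ → w = z := fun w hw =>
    Sym2.congr_right.mp (huniq _ ⟨hw, Sym2.mem_mk_left x w⟩)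
  have hp : s(x, partner σ x) ∈ σ := by
    rw [partner, dif_pos hex]
    exact hex.choose_spec
  constructor
  · intro hy
    rw [hunique _ hp, hunique _ hy]
  · rintro rfl
    exact hp

theorem IsPM.partner_partner {G : SimpleGraph V} {σ : Set (Sym2 V)} (h : IsPM G σ) (x : V) :
    partner σ (partner σ x) = x := by
  rw [← h.mem_iff, Sym2.eq_swap, h.mem_iff]

theorem IsPM.adj_partner {G : SimpleGraph V} {σ : Set (Sym2 V)} (h : IsPM G σ) (x : V) :
    G.Adj x (partner σ x) :=
  h.1 ((h.mem_iff x _).mpr rfl)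

theorem isPM_of_mem_iff {G : SimpleGraph V} {σ : Set (Sym2 V)} {f : V → V}
    (hadj : ∀ x, G.Adj x (f x)) (hmem : ∀ x y, s(x, y) ∈ σ ↔ f x = y) : IsPM G σ := by
  refine ⟨fun e => ?_, fun v => ⟨s(v, f v), ⟨(hmem _ _).mpr rfl, Sym2.mem_mk_left _ _⟩, ?_⟩⟩
  · induction e with
    | _ x y =>
      intro he
      rw [SimpleGraph.mem_edgeSet, ← (hmem x y).mp he]
      exact hadj x
  · rintro e ⟨he, hve⟩
    obtain ⟨w, rfl⟩ := Sym2.mem_iff_exists.mp hve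
    rw [(hmem v w).mp he]

/-- The partner function of `ψ̂({u,v}, σ)` when `f` is the partner function of `σ`. -/
def rematch (f : V → V) (u v x : V) : V :=
  if x = u then v else if x = v then u else
    if x = f u then f v else if x = f v then f u else f x

theorem IsPM.mem_psiHat_iff {G : SimpleGraph V} {σ : Set (Sym2 V)} (h : IsPM G σ) {u v : V}
    (huv : u ≠ v) (x y : V) :
    s(x, y) ∈ psiHat σ u v ↔ rematch (partner σ) u v x = y := by
  have hinv := h.partner_partner
  have hfix : ∀ x, partner σ x ≠ x := fun x => (h.adj_partner x).ne'
  simp only [psiHat, rematch, Set.mem_union, Set.mem_sdiff, Set.mem_insert_iff,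
    Set.mem_singleton_iff, h.mem_iff, Sym2.eq_iff]
  grind

theorem IsPM.adj_rematch {G : SimpleGraph V} (hstar : CondStar G) {σ : Set (Sym2 V)}
    (h : IsPM G σ) {u v : V} (huv : G.Adj u v) (x : V) :
    G.Adj x (rematch (partner σ) u v x) := by
  have hinv := h.partner_partner
  have hu := h.adj_partner u
  have hv := h.adj_partner v
  have hne := huv.ne
  have hkey : partner σ u ≠ v → G.Adj (partner σ u) (partner σ v) := fun huv' =>
    hstar _ u v _ hu.ne' huv' (by grind) hne (by grind) hv.ne hu.symm huv hv
  unfold rematch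
  split_ifs with h1 h2 h3 h4
  · exact h1 ▸ huv
  · exact h2 ▸ huv.symm
  · exact h3 ▸ hkey (by grind)
  · exact h4 ▸ (hkey (by grind)).symm
  · exact h.adj_partner x

theorem IsPM.psiHat {G : SimpleGraph V} (hstar : CondStar G) {σ : Set (Sym2 V)}
    (h : IsPM G σ) {u v : V} (huv : G.Adj u v) : IsPM G (psiHat σ u v) :=
  isPM_of_mem_iff (h.adj_rematch hstar huv) (h.mem_psiHat_iff huv.ne)

theorem IsPM.partner_psiHat {G : SimpleGraph V} (hstar : CondStar G) {σ : Set (Sym2 V)}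
    (h : IsPM G σ) {u v : V} (huv : G.Adj u v) :
    partner (PMFormal.psiHat σ u v) = rematch (partner σ) u v := by
  funext x
  rw [← (h.psiHat hstar huv).mem_iff, h.mem_psiHat_iff huv.ne]

theorem rematch_comm {f : V → V} (hinv : ∀ x, f (f x) = x) (hfix : ∀ x, f x ≠ x)
    {a b c d : V}
    (hac : a ≠ c) (had : a ≠ d) (hbc : b ≠ c) (hbd : b ≠ d) (hab : a ≠ b) (hcd : c ≠ d) (x : V) :
    rematch (rematch f c d) a b x = rematch (rematch f a b) c d x := by
  unfold rematch
  grind (splits := 40)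

/-- for a finite simple graph `G` on an even number of vertices satisfying
condition (*), a perfect matching `σ` of `G` and vertex-disjoint edges `{a,b}`, `{c,d}`
of `G`, `ψ̂({a,b}, ψ̂({c,d}, σ)) = ψ̂({c,d}, ψ̂({a,b}, σ))`, and this common perfect
matching contains both edges. -/
theorem stmt_18 {V : Type*} [Fintype V]
    (G : SimpleGraph V) (heven : Even (Fintype.card V)) (hstar : CondStar G)
    (σ : Set (Sym2 V)) (hσ : IsPM G σ)
    (a b c d : V) (hac : a ≠ c) (had : a ≠ d) (hbc : b ≠ c) (hbd : b ≠ d)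
    (hab : G.Adj a b) (hcd : G.Adj c d) :
    psiHat (psiHat σ c d) a b = psiHat (psiHat σ a b) c d ∧
    IsPM G (psiHat (psiHat σ c d) a b) ∧
    s(a, b) ∈ psiHat (psiHat σ c d) a b ∧
    s(c, d) ∈ psiHat (psiHat σ c d) a b := by
  have h1 := hσ.psiHat hstar hcd
  have h2 := hσ.psiHat hstar hab
  have hcomm : psiHat (psiHat σ c d) a b = psiHat (psiHat σ a b) c d := by
    ext e
    induction e with
    | _ x y =>
      rw [h1.mem_psiHat_iff hab.ne, h2.mem_psiHat_iff hcd.ne, hσ.partner_psiHat hstar hcd,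
        hσ.partner_psiHat hstar hab,
        rematch_comm hσ.partner_partner (fun x => (hσ.adj_partner x).ne') hac had hbc hbd hab.ne hcd.ne]
  refine ⟨hcomm, h1.psiHat hstar hab, Or.inr (Or.inl rfl), ?_⟩
  rw [hcomm]
  exact Or.inr (Or.inl rfl)

end PMFormal
end
end
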